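/- The critical value of g does not exceed the right endpoint of the invariant interval: letting c be the unique point in (0, b) with g'(c) = 0, one has 0 < g(c) ≤ b, and consequently g([0, b]) = [0, g(c)] ⊆ [0, b]. -/

import Mathlib

noncomputable def g (x : ℝ) : ℝ :=
  (5/2) * x - x ^ 2 / 10 - x ^ 3 / 50 - x ^ 4 / 2000

theorem hasDerivAt_g (x : ℝ) :
    HasDerivAt g (5/2 - x / 5 - 3 * x ^ 2 / 50 - x ^ 3 / 500) x := by
  have h := ((((hasDerivAt_id x).const_mul (5/2 : ℝ)).sub
    ((hasDerivAt_pow 2 x).div_const 10)).sub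
    ((hasDerivAt_pow 3 x).div_const 50)).sub ((hasDerivAt_pow 4 x).div_const 2000)
  refine h.congr_deriv ?_
  norm_num
  ring

theorem g_le_of_deriv_eq_zero {c x : ℝ} (hc : 0 ≤ c) (hx : 0 ≤ x) (h : deriv g c = 0) :
    g x ≤ g c := by
  rw [(hasDerivAt_g c).deriv] at h
  have key : g c - g x = (x - c) ^ 2 *
      (1 / 10 + (x + 2 * c) / 50 + (x ^ 2 + 2 * x * c + 3 * c ^ 2) / 2000) := by
    unfold g
    linear_combination (c - x) * h
  have : 0 ≤ g c - g x := by rw [key]; positivity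
  linarith

theorem g_pos_of_lt_root {b x : ℝ} (hb : g b = 0) (hx : 0 < x) (hxb : x < b) : 0 < g x := by
  have hb0 : 0 < b := hx.trans hxb
  have key : b * g x = x * b * (b - x) *
      (1 / 10 + (x + b) / 50 + (x ^ 2 + x * b + b ^ 2) / 2000) := by
    unfold g at *
    linear_combination x * hb
  have hsub : 0 < b - x := sub_pos.2 hxb
  have : 0 < b * g x := by rw [key]; positivity
  exact pos_of_mul_pos_right this hb0.le

theorem g_le_eight {x : ℝ} (hx : 0 ≤ x) : g x ≤ 8 := by
  have h3 : 0 ≤ (x - 47 / 10) ^ 2 * (x + 2 * (47 / 10)) := by positivity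
  have h4 : 0 ≤ (x - 47 / 10) ^ 2 * (x ^ 2 + 2 * x * (47 / 10) + 3 * (47 / 10) ^ 2) := by
    positivity
  unfold g
  nlinarith [sq_nonneg (x - 47 / 10)]

theorem eight_le_of_g_eq_zero {b : ℝ} (hb0 : 0 < b) (hb : g b = 0) : 8 ≤ b := by
  by_contra! hlt
  have h2 : b ^ 2 ≤ 8 ^ 2 := by gcongr
  have h3 : b ^ 3 ≤ 8 ^ 3 := by gcongr
  have hfac : g b = b * (5 / 2 - b / 10 - b ^ 2 / 50 - b ^ 3 / 2000) := by
    unfold g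
    ring
  have : 0 < g b := by
    rw [hfac]
    exact mul_pos hb0 (by linarith)
  exact this.ne' hb

theorem critical_value_bounds
    (b : ℝ) (hb_pos : 0 < b) (hb_root : g b = 0)
    (hb_unique : ∀ y : ℝ, 0 < y → g y = 0 → y = b)
    (c : ℝ) (hc : c ∈ Set.Ioo (0 : ℝ) b) (hc_crit : deriv g c = 0)
    (hc_unique : ∀ c' ∈ Set.Ioo (0 : ℝ) b, deriv g c' = 0 → c' = c) :
    0 < g c ∧ g c ≤ b ∧ g '' Set.Icc (0 : ℝ) b = Set.Icc (0 : ℝ) (g c) ∧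
    Set.Icc (0 : ℝ) (g c) ⊆ Set.Icc (0 : ℝ) b := by
  obtain ⟨hc0, hcb⟩ := hc
  have g_zero : g 0 = 0 := by simp [g]
  have hle : g c ≤ b := (g_le_eight hc0.le).trans (eight_le_of_g_eq_zero hb_pos hb_root)
  refine ⟨g_pos_of_lt_root hb_root hc0 hcb, hle, Set.Subset.antisymm ?_ ?_,
    Set.Icc_subset_Icc_right hle⟩
  · rintro _ ⟨x, ⟨hx0, hxb⟩, rfl⟩
    refine ⟨?_, g_le_of_deriv_eq_zero hc0.le hx0 hc_crit⟩
    rcases hx0.eq_or_lt with rfl | hx0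
    · exact g_zero.ge
    rcases hxb.eq_or_lt with rfl | hxb
    · exact hb_root.ge
    exact (g_pos_of_lt_root hb_root hx0 hxb).le
  · have hcont : ContinuousOn g (Set.Icc 0 c) :=
      fun x _ => (hasDerivAt_g x).continuousAt.continuousWithinAt
    have hivt := intermediate_value_Icc hc0.le hcont
    rw [g_zero] at hivt
    exact hivt.trans (Set.image_mono (Set.Icc_subset_Icc_right hcb.le))
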